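/- Under the assumptions that the cross-sectional error covariance matrix is the identity at every temporal granularity (W = I_n) and the temporal error covariance matrix is the identity for every series (Ω = I_{T}), the optimal combination cross-temporal reconciliation projector with covariance Ω_ct = I_{nT} equals the Kronecker product of the two orthogonal projectors: for any H with kernel { v : (Uᵀ ⊗ I_T)v = 0 and (I_n ⊗ Zᵀ)v = 0 } and H·Hᵀ invertible, I_{nT} − Hᵀ(HHᵀ)⁻¹H = (I_n − U(UᵀU)⁻¹Uᵀ) ⊗ (I_T − Z(ZᵀZ)⁻¹Zᵀ). Hence the OLS cross-temporal reconciliation oct(ols) is equivalent to the sequential OLS procedures in either order. -/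

import Mathlib

open Matrix Kronecker

theorem aux_ks {m p : Type*} (M : Matrix m m ℝ) (X Y : Matrix p p ℝ) :
    M ⊗ₖ (X - Y) = M ⊗ₖ X - M ⊗ₖ Y := by
  ext i j
  simp [Matrix.kroneckerMap_apply, mul_sub]

theorem aux_sk {m p : Type*} (X Y : Matrix m m ℝ) (M : Matrix p p ℝ) :
    (X - Y) ⊗ₖ M = X ⊗ₖ M - Y ⊗ₖ M := by
  ext i j
  simp [Matrix.kroneckerMap_apply, sub_mul]

theorem aux_symm {m p : Type*} [Fintype m] [Fintype p] [DecidableEq m] [DecidableEq p]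
    (M : Matrix m p ℝ) :
    ((1 : Matrix p p ℝ) - Mᵀ * (M * Mᵀ)⁻¹ * M)ᵀ = 1 - Mᵀ * (M * Mᵀ)⁻¹ * M := by
  simp [Matrix.transpose_mul, Matrix.transpose_nonsing_inv, Matrix.mul_assoc]

theorem aux_kill {m p : Type*} [Fintype m] [Fintype p] [DecidableEq m] [DecidableEq p]
    (M : Matrix m p ℝ) (h : IsUnit (M * Mᵀ)) :
    M * ((1 : Matrix p p ℝ) - Mᵀ * (M * Mᵀ)⁻¹ * M) = 0 := by
  have h' := (Matrix.isUnit_iff_isUnit_det _).1 h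
  rw [Matrix.mul_sub, ← Matrix.mul_assoc, ← Matrix.mul_assoc, Matrix.mul_nonsing_inv _ h']
  simp

theorem aux_mul_zero {m p q : Type*} [Fintype p] 
    (M : Matrix m p ℝ) (N : Matrix p q ℝ) :
    M * N = 0 ↔ ∀ j, M.mulVec (fun i => N i j) = 0 := by
  constructor
  · intro h j
    ext i
    exact congrFun (congrFun h i) j
  · intro h
    ext i j
    exact congrFun (h j) i

/-- with identity covariance matrices (W = I_n, Ω = I_T), the
optimal combination cross-temporal reconciliation projector with covariance
Ω_ct = I_{nT} equals the Kronecker product of the two orthogonal projectors: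
I − Hᵀ(HHᵀ)⁻¹H = (I − U(UᵀU)⁻¹Uᵀ) ⊗ (I − Z(ZᵀZ)⁻¹Zᵀ), so oct(ols) is
equivalent to the sequential OLS procedures in either order. -/
theorem stmt_13 {n na T k c : ℕ}
    (U : Matrix (Fin n) (Fin na) ℝ) (hU : IsUnit (Uᵀ * U))
    (Z : Matrix (Fin T) (Fin k) ℝ) (hZ : IsUnit (Zᵀ * Z))
    (H : Matrix (Fin c) (Fin n × Fin T) ℝ)
    (hHker : ∀ v : Fin n × Fin T → ℝ,
      H.mulVec v = 0 ↔
        ((Uᵀ ⊗ₖ (1 : Matrix (Fin T) (Fin T) ℝ)).mulVec v = 0 ∧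
          (((1 : Matrix (Fin n) (Fin n) ℝ)) ⊗ₖ Zᵀ).mulVec v = 0))
    (hHH : IsUnit (H * Hᵀ)) :
    (1 : Matrix (Fin n × Fin T) (Fin n × Fin T) ℝ) - Hᵀ * (H * Hᵀ)⁻¹ * H =
      ((1 : Matrix (Fin n) (Fin n) ℝ) - U * (Uᵀ * U)⁻¹ * Uᵀ) ⊗ₖ
        ((1 : Matrix (Fin T) (Fin T) ℝ) - Z * (Zᵀ * Z)⁻¹ * Zᵀ) := by
  have hker : ∀ N : Matrix (Fin n × Fin T) (Fin n × Fin T) ℝ, H * N = 0 ↔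
      ((Uᵀ ⊗ₖ (1 : Matrix (Fin T) (Fin T) ℝ)) * N = 0 ∧
        ((1 : Matrix (Fin n) (Fin n) ℝ) ⊗ₖ Zᵀ) * N = 0) := by
    intro N
    simp only [aux_mul_zero, hHker, forall_and]
  have hA := aux_kill Uᵀ (by simpa using hU)
  have hB := aux_kill Zᵀ (by simpa using hZ)
  have sA := aux_symm Uᵀ
  have sB := aux_symm Zᵀ
  have hP := aux_kill H hHH
  have sP := aux_symm H
  simp only [Matrix.transpose_transpose] at hA hB sA sB
  set A := (1 : Matrix (Fin n) (Fin n) ℝ) - U * (Uᵀ * U)⁻¹ * Uᵀ with hAd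
  set B := (1 : Matrix (Fin T) (Fin T) ℝ) - Z * (Zᵀ * Z)⁻¹ * Zᵀ with hBd
  set P := (1 : Matrix (Fin n × Fin T) (Fin n × Fin T) ℝ) - Hᵀ * (H * Hᵀ)⁻¹ * H with hPd
  have hQ : H * (A ⊗ₖ B) = 0 := by
    rw [hker, ← Matrix.mul_kronecker_mul, ← Matrix.mul_kronecker_mul, hA, hB]
    simp
  have hPQ : P * (A ⊗ₖ B) = A ⊗ₖ B := by
    rw [hPd, Matrix.sub_mul, Matrix.mul_assoc _ H, hQ]
    simp
  obtain ⟨h1, h2⟩ := (hker P).1 hP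
  have hBP : ((1 : Matrix (Fin n) (Fin n) ℝ) ⊗ₖ B) * P = P := by
    have e : (1 : Matrix (Fin n) (Fin n) ℝ) ⊗ₖ B =
        1 - ((1 : Matrix (Fin n) (Fin n) ℝ) ⊗ₖ (Z * (Zᵀ * Z)⁻¹)) *
          ((1 : Matrix (Fin n) (Fin n) ℝ) ⊗ₖ Zᵀ) := by
      rw [← Matrix.mul_kronecker_mul, hBd, aux_ks, Matrix.one_kronecker_one,
        Matrix.mul_one]
    rw [e, Matrix.sub_mul, Matrix.mul_assoc _ _ P, h2]
    simp
  have hAP : (A ⊗ₖ (1 : Matrix (Fin T) (Fin T) ℝ)) * P = P := by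
    have e : A ⊗ₖ (1 : Matrix (Fin T) (Fin T) ℝ) =
        1 - ((U * (Uᵀ * U)⁻¹) ⊗ₖ (1 : Matrix (Fin T) (Fin T) ℝ)) *
          (Uᵀ ⊗ₖ (1 : Matrix (Fin T) (Fin T) ℝ)) := by
      rw [← Matrix.mul_kronecker_mul, hAd, aux_sk, Matrix.one_kronecker_one,
        Matrix.mul_one]
    rw [e, Matrix.sub_mul, Matrix.mul_assoc _ _ P, h1]
    simp
  have hQP : (A ⊗ₖ B) * P = P := by
    have e : A ⊗ₖ B = (A ⊗ₖ (1 : Matrix (Fin T) (Fin T) ℝ)) *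
        ((1 : Matrix (Fin n) (Fin n) ℝ) ⊗ₖ B) := by
      rw [← Matrix.mul_kronecker_mul, Matrix.mul_one, Matrix.one_mul]
    rw [e, Matrix.mul_assoc, hBP, hAP]
  have hT : (A ⊗ₖ B)ᵀ = A ⊗ₖ B := by
    rw [← Matrix.kroneckerMap_transpose, sA, sB]
  have := congrArg Matrix.transpose hQP
  rw [Matrix.transpose_mul, sP, hT, hPQ] at this
  exact this.symm
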